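/- There is an absolute constant c > 0 such that every nondeterministic branching program of size s computing a Boolean function f : {0,1}^n → {0,1} can be converted to a deterministic Boolean circuit computing f of size at most 2^{c·(log₂ s)²} and width at most c·log₂ s. -/

import Mathlib

/-!
Common definitions: Boolean circuits (with AND/OR/NOT gates of fan-in ≤ 2 and
dummy COPY gates used only for layering), nondeterministic circuits with guess
inputs, width via layerings, nondeterministic branching programs, and
U₂-circuits with their deterministic/nondeterministic circuit complexities.
-/

/-- A node of a circuit with `n` actual inputs and `m` guess inputs.
Gate nodes refer to their predecessors by (strictly smaller) indices. -/
inductive CNode (n m : ℕ) : Type where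
  | actual : Fin n → CNode n m
  | guess  : Fin m → CNode n m
  | const  : Bool → CNode n m
  | gand   : ℕ → ℕ → CNode n m
  | gor    : ℕ → ℕ → CNode n m
  | gnot   : ℕ → CNode n m
  | gcopy  : ℕ → CNode n m
deriving DecidableEq

namespace CNode

/-- The predecessor indices of a node. -/
def preds {n m : ℕ} : CNode n m → List ℕ
  | gand j k => [j, k]
  | gor j k  => [j, k]
  | gnot j   => [j]
  | gcopy j  => [j]
  | _        => []

/-- Real gates (AND, OR, NOT); these are the gates counted in the size.
COPY gates are dummy gates inserted only to make the circuit layered. -/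
def isGate {n m : ℕ} : CNode n m → Bool
  | gand _ _ => true
  | gor _ _  => true
  | gnot _   => true
  | _        => false

/-- Nodes occupying space in a layer (real gates and COPY gates);
these are counted in the width of a layer. -/
def isWide {n m : ℕ} : CNode n m → Bool
  | gand _ _ => true
  | gor _ _  => true
  | gnot _   => true
  | gcopy _  => true
  | _        => false

end CNode

/-- A (nondeterministic) Boolean circuit with `n` actual inputs and `m` guess
inputs: a DAG whose in-degree-0 nodes are labeled by actual inputs, guess
inputs or constants, whose gates are AND/OR/NOT gates (plus dummy COPY gates),
with a designated output node.  Each guess input labels at most one node. -/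
structure Circuit (n m : ℕ) : Type where
  N : ℕ
  node : Fin N → CNode n m
  output : Fin N
  wf : ∀ i : Fin N, ∀ j ∈ (node i).preds, j < (i : ℕ)
  guessOnce : ∀ g : Fin m,
    (Finset.univ.filter (fun i : Fin N => node i = CNode.guess g)).card ≤ 1

namespace Circuit

variable {n m : ℕ}

def nodeAt (c : Circuit n m) (i : ℕ) : CNode n m :=
  if h : i < c.N then c.node ⟨i, h⟩ else CNode.const false

/-- The Boolean value computed at node `i` on actual inputs `x` and
guess inputs `y`. -/
def evalAux (c : Circuit n m) (x : Fin n → Bool) (y : Fin m → Bool) : ℕ → Bool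
  | i =>
    match c.nodeAt i with
    | CNode.actual a => x a
    | CNode.guess g => y g
    | CNode.const b => b
    | CNode.gand j k =>
        (if _h : j < i then c.evalAux x y j else false) &&
        (if _h : k < i then c.evalAux x y k else false)
    | CNode.gor j k =>
        (if _h : j < i then c.evalAux x y j else false) ||
        (if _h : k < i then c.evalAux x y k else false)
    | CNode.gnot j => !(if _h : j < i then c.evalAux x y j else false)
    | CNode.gcopy j => (if _h : j < i then c.evalAux x y j else false)
termination_by i => i

/-- The output value of the circuit. -/
def eval (c : Circuit n m) (x : Fin n → Bool) (y : Fin m → Bool) : Bool :=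
  c.evalAux x y c.output

/-- A nondeterministic circuit computes `f` if for every actual input `x`,
`f x = 1` iff some assignment of the guess inputs makes the circuit output 1.
(For `m = 0` this is the usual notion for deterministic circuits.) -/
def Computes (c : Circuit n m) (f : (Fin n → Bool) → Bool) : Prop :=
  ∀ x : Fin n → Bool, f x = true ↔ ∃ y : Fin m → Bool, c.eval x y = true

/-- The size of a circuit: the number of (non-COPY) gates. -/
def size (c : Circuit n m) : ℕ :=
  (Finset.univ.filter (fun i : Fin c.N => (c.node i).isGate = true)).card

/-- `ℓ` is a layering of the circuit: every wire goes between adjacent layers. -/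
def IsLayering (c : Circuit n m) (ℓ : Fin c.N → ℕ) : Prop :=
  ∀ i : Fin c.N, ∀ j ∈ (c.node i).preds, ∀ hj : j < c.N, ℓ ⟨j, hj⟩ + 1 = ℓ i

/-- The circuit has width at most `w`: there is a layering in which every layer
contains at most `w` gates (real gates and COPY gates). -/
def HasWidth (c : Circuit n m) (w : ℕ) : Prop :=
  ∃ ℓ : Fin c.N → ℕ, c.IsLayering ℓ ∧
    ∀ t : ℕ,
      (Finset.univ.filter
        (fun i : Fin c.N => ℓ i = t ∧ (c.node i).isWide = true)).card ≤ w

/-- The circuit is read-`k`-times: every actual input labels at most `k` nodes. -/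
def ReadK (c : Circuit n m) (k : ℕ) : Prop :=
  ∀ a : Fin n,
    (Finset.univ.filter (fun i : Fin c.N => c.node i = CNode.actual a)).card ≤ k

/-- The maximal number of (non-COPY) gates on a path ending at node `i`. -/
def depthAux (c : Circuit n m) : ℕ → ℕ
  | i =>
    match c.nodeAt i with
    | CNode.actual _ => 0
    | CNode.guess _ => 0
    | CNode.const _ => 0
    | CNode.gand j k =>
        max (if _h : j < i then c.depthAux j else 0)
            (if _h : k < i then c.depthAux k else 0) + 1
    | CNode.gor j k =>
        max (if _h : j < i then c.depthAux j else 0)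
            (if _h : k < i then c.depthAux k else 0) + 1
    | CNode.gnot j => (if _h : j < i then c.depthAux j else 0) + 1
    | CNode.gcopy j => (if _h : j < i then c.depthAux j else 0)
termination_by i => i

/-- The depth of a circuit: the maximal number of gates on a directed path
from an input to the output. -/
def depth (c : Circuit n m) : ℕ := c.depthAux c.output

end Circuit

/-- A nondeterministic branching program on `n` Boolean variables: a DAG whose
inner nodes are labeled by variables with outgoing edges labeled 0 or 1 (edges
go to strictly larger indices), whose sinks are labeled 0 or 1, with a
designated start node. -/
structure NBP (n : ℕ) : Type where
  N : ℕ
  label : Fin N → Fin n ⊕ Bool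
  edges : Fin N → Bool → Finset (Fin N)
  start : Fin N
  wf : ∀ i : Fin N, ∀ b : Bool, ∀ j ∈ edges i b,
        (i : ℕ) < (j : ℕ) ∧ (label i).isLeft

namespace NBP

variable {n : ℕ}

/-- The size of a branching program: the number of its nodes. -/
def size (B : NBP n) : ℕ := B.N

/-- On input `x`, some path from node `i` consistent with `x` reaches a 1-sink. -/
def AccFrom (B : NBP n) (x : Fin n → Bool) : Fin B.N → Prop
  | i =>
    match B.label i with
    | Sum.inr b => b = true
    | Sum.inl v => ∃ j ∈ B.edges i (x v), ∃ _h : (i : ℕ) < (j : ℕ), B.AccFrom x j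
termination_by i => B.N - (i : ℕ)
decreasing_by
  have := j.isLt
  omega

/-- A nondeterministic branching program computes `f` if for every `x`,
`f x = 1` iff at least one path consistent with `x` leads to a 1-sink. -/
def Computes (B : NBP n) (f : (Fin n → Bool) → Bool) : Prop :=
  ∀ x : Fin n → Bool, f x = true ↔ B.AccFrom x B.start

/-- A (syntactic) path in the underlying graph of the branching program. -/
def IsPath (B : NBP n) : List (Fin B.N) → Prop
  | [] => True
  | [_] => True
  | i :: j :: p => (∃ b : Bool, j ∈ B.edges i b) ∧ B.IsPath (j :: p)

/-- The branching program is syntactic read-`k`-times: every variable appears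
at most `k` times on each path. -/
def SyntacticReadK (B : NBP n) (k : ℕ) : Prop :=
  ∀ p : List (Fin B.N), B.IsPath p → ∀ v : Fin n,
    (p.countP fun i => decide (B.label i = Sum.inl v)) ≤ k

end NBP

/-- A node of a `U₂`-circuit.  A gate `gate a b c j k` computes
`((vⱼ ⊕ a) ∧ (v_k ⊕ b)) ⊕ c` from the values `vⱼ, v_k` of its two
predecessors; these are exactly the Boolean functions in `U₂`
(all two-variable Boolean functions except XOR and its complement). -/
inductive U2Node (n m : ℕ) : Type where
  | actual : Fin n → U2Node n m
  | guess  : Fin m → U2Node n m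
  | const  : Bool → U2Node n m
  | gate   : Bool → Bool → Bool → ℕ → ℕ → U2Node n m
deriving DecidableEq

namespace U2Node

def isGate {n m : ℕ} : U2Node n m → Bool
  | gate _ _ _ _ _ => true
  | _ => false

end U2Node

/-- A (nondeterministic) `U₂`-circuit with `n` actual inputs and `m` guess
inputs: every gate has fan-in 2 and is labeled by a function in `U₂`. -/
structure U2Circuit (n m : ℕ) : Type where
  N : ℕ
  node : Fin N → U2Node n m
  output : Fin N
  wf : ∀ i : Fin N, ∀ a b c j k,
        node i = U2Node.gate a b c j k → j < (i : ℕ) ∧ k < (i : ℕ)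

namespace U2Circuit

variable {n m : ℕ}

def nodeAt (c : U2Circuit n m) (i : ℕ) : U2Node n m :=
  if h : i < c.N then c.node ⟨i, h⟩ else U2Node.const false

def evalAux (c : U2Circuit n m) (x : Fin n → Bool) (y : Fin m → Bool) : ℕ → Bool
  | i =>
    match c.nodeAt i with
    | U2Node.actual a => x a
    | U2Node.guess g => y g
    | U2Node.const b => b
    | U2Node.gate a b cc j k =>
        xor
          ((xor (if _h : j < i then c.evalAux x y j else false) a) &&
           (xor (if _h : k < i then c.evalAux x y k else false) b))
          cc
termination_by i => i

def eval (c : U2Circuit n m) (x : Fin n → Bool) (y : Fin m → Bool) : Bool :=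
  c.evalAux x y c.output

/-- A nondeterministic `U₂`-circuit computes `f` if for every actual input `x`,
`f x = 1` iff some assignment of the guess inputs makes the circuit output 1. -/
def Computes (c : U2Circuit n m) (f : (Fin n → Bool) → Bool) : Prop :=
  ∀ x : Fin n → Bool, f x = true ↔ ∃ y : Fin m → Bool, c.eval x y = true

/-- The size of a `U₂`-circuit: the number of its gates. -/
def size (c : U2Circuit n m) : ℕ :=
  (Finset.univ.filter (fun i : Fin c.N => (c.node i).isGate = true)).card

end U2Circuit

/-- `size^dc f`: the size of the smallest deterministic `U₂`-circuit
computing `f`. -/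
noncomputable def sizeDC {n : ℕ} (f : (Fin n → Bool) → Bool) : ℕ :=
  sInf {s : ℕ | ∃ c : U2Circuit n 0, c.Computes f ∧ c.size = s}

/-- `size^ndc f`: the size of the smallest nondeterministic `U₂`-circuit
computing `f`. -/
noncomputable def sizeNDC {n : ℕ} (f : (Fin n → Bool) → Bool) : ℕ :=
  sInf {s : ℕ | ∃ m : ℕ, ∃ c : U2Circuit n m, c.Computes f ∧ c.size = s}

/-- The parity function: `parityFun n x = 1` iff `Σ xᵢ ≡ 1 (mod 2)`. -/
def parityFun (n : ℕ) : (Fin n → Bool) → Bool :=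
  fun x => decide ((∑ i : Fin n, (x i).toNat) % 2 = 1)

theorem blockIdx_lt {m : ℕ} (i j : Fin m) : m * (i : ℕ) + (j : ℕ) < m * m := by
  have hi := i.isLt
  have hj := j.isLt
  nlinarith

/-- The disjunction of the parities of the `m` consecutive blocks of `m`
variables:
`⋁_{i=0}^{m-1} Parity_m (x_{m·i+1}, …, x_{m·i+m})` on `n = m²` variables. -/
def blockParityOr (m : ℕ) : (Fin (m * m) → Bool) → Bool :=
  fun x => decide (∃ i : Fin m,
    parityFun m (fun j => x ⟨m * (i : ℕ) + (j : ℕ), blockIdx_lt i j⟩) = true)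

namespace CNode

variable {n m : ℕ}

/-- Renumber the predecessors of a node by adding `d`. -/
def shift (d : ℕ) : CNode n m → CNode n m
  | gand j k => gand (d + j) (d + k)
  | gor j k  => gor (d + j) (d + k)
  | gnot j   => gnot (d + j)
  | gcopy j  => gcopy (d + j)
  | actual a => actual a
  | guess g  => guess g
  | const b  => const b

/-- The value of a node when its predecessors carry the values `σ`. -/
def val (x : Fin n → Bool) (y : Fin m → Bool) (σ : ℕ → Bool) : CNode n m → Bool
  | gand j k => σ j && σ k
  | gor j k  => σ j || σ k
  | gnot j   => !σ j
  | gcopy j  => σ j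
  | actual a => x a
  | guess g  => y g
  | const b  => b

theorem mem_preds_shift {d j : ℕ} {v : CNode n m} :
    j ∈ (v.shift d).preds ↔ ∃ a ∈ v.preds, j = d + a := by
  cases v <;> simp [shift, preds]

theorem val_shift (x : Fin n → Bool) (y : Fin m → Bool) (σ : ℕ → Bool) (d : ℕ)
    (v : CNode n m) : (v.shift d).val x y σ = v.val x y (fun a => σ (d + a)) := by
  cases v <;> rfl

theorem val_congr (x : Fin n → Bool) (y : Fin m → Bool) {σ τ : ℕ → Bool}
    {v : CNode n m} (h : ∀ j ∈ v.preds, σ j = τ j) : v.val x y σ = v.val x y τ := by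
  cases v <;> simp_all [val, preds]

end CNode

theorem Circuit.evalAux_eq_val {n m : ℕ} (c : Circuit n m) (x : Fin n → Bool)
    (y : Fin m → Bool) (i : Fin c.N) :
    c.evalAux x y i = (c.node i).val x y (c.evalAux x y) := by
  have hwf := c.wf i
  have hat : c.nodeAt i = c.node i := by simp [Circuit.nodeAt]
  rw [Circuit.evalAux, hat]
  cases h : c.node i <;> simp_all [CNode.val, CNode.preds]

/-- A register program: each instruction `(r, v)` stores in register `r` the value
of the node `v`, whose predecessors are read as register numbers. -/
abbrev RegProg (n : ℕ) : Type := List (ℕ × CNode n 0)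

namespace RegProg

variable {n : ℕ}

/-- The register contents after one instruction. -/
def step (x : Fin n → Bool) (σ : ℕ → Bool) (ins : ℕ × CNode n 0) : ℕ → Bool :=
  Function.update σ ins.1 (ins.2.val x Fin.elim0 σ)

/-- The register contents after running a program from contents `σ`. -/
def run (x : Fin n → Bool) (P : RegProg n) (σ : ℕ → Bool) : ℕ → Bool :=
  P.foldl (step x) σ

theorem run_append (x : Fin n → Bool) (P Q : RegProg n) (σ : ℕ → Bool) :
    run x (P ++ Q) σ = run x Q (run x P σ) := by
  simp [run]

/-- All registers read by the program are smaller than `W`. -/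
def ReadsBelow (P : RegProg n) (W : ℕ) : Prop :=
  ∀ ins ∈ P, ∀ a ∈ ins.2.preds, a < W

/-- The node at grid position `i` in the layered circuit simulating `P` with `W`
registers: position `t * W + r` carries the content of register `r` at time `t`. -/
def gridNode (P : RegProg n) (W i : ℕ) : CNode n 0 :=
  if i < W then CNode.const false
  else match P[i / W - 1]? with
    | none => CNode.const false
    | some ins =>
      if i % W = ins.1 then ins.2.shift ((i / W - 1) * W) else CNode.gcopy (i - W)

theorem gridNode_preds {P : RegProg n} {W : ℕ} (hW : 0 < W) (hP : P.ReadsBelow W)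
    {i j : ℕ} (hj : j ∈ (P.gridNode W i).preds) : j < i ∧ j / W + 1 = i / W := by
  unfold gridNode at hj
  split_ifs at hj with hi
  · simp [CNode.preds] at hj
  have h1 : 1 ≤ i / W := (Nat.one_le_div_iff hW).2 (not_lt.1 hi)
  obtain ⟨t, ht⟩ := Nat.exists_eq_add_of_le' h1
  have hdiv : (t + 1) * W ≤ i := ht ▸ Nat.div_mul_le_self i W
  rw [ht, Nat.add_sub_cancel] at hj
  rw [ht]
  split at hj
  · simp [CNode.preds] at hj
  · rename_i ins hins
    split_ifs at hj with hr
    · obtain ⟨a, ha, rfl⟩ := CNode.mem_preds_shift.1 hj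
      have haW : a < W := hP ins (List.mem_of_getElem? hins) a ha
      constructor
      · nlinarith
      · rw [Nat.mul_comm, Nat.mul_add_div hW, Nat.div_eq_of_lt haW]
    · simp only [CNode.preds, List.mem_singleton] at hj
      subst hj
      constructor
      · omega
      · rw [← Nat.div_eq_sub_div hW (not_lt.1 hi), ht]

/-- The layered circuit simulating a register program on `W` registers and
outputting register `0`. -/
def toCircuit (P : RegProg n) (W : ℕ) (hW : 0 < W) (hP : P.ReadsBelow W) :
    Circuit n 0 where
  N := (P.length + 1) * W
  node i := P.gridNode W i
  output := ⟨P.length * W, by nlinarith⟩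
  wf _ _ hj := (gridNode_preds hW hP hj).1
  guessOnce g := g.elim0

variable {P : RegProg n} {W : ℕ} (hW : 0 < W) (hP : P.ReadsBelow W)

theorem toCircuit_size_le : (P.toCircuit W hW hP).size ≤ (P.length + 1) * W :=
  (Finset.card_filter_le _ _).trans_eq (Finset.card_univ.trans (Fintype.card_fin _))

theorem toCircuit_hasWidth : (P.toCircuit W hW hP).HasWidth W := by
  refine ⟨fun i => (i : ℕ) / W, fun i j hj _ => (gridNode_preds hW hP hj).2, fun t => ?_⟩
  refine (Finset.card_le_card_of_injOn (t := Finset.range W)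
    (fun i : Fin (P.toCircuit W hW hP).N => (i : ℕ) % W)
    (fun i _ => by simpa using Nat.mod_lt _ hW) ?_).trans_eq (Finset.card_range W)
  intro i hi j hj hij
  simp only [Finset.coe_filter, Finset.mem_univ, true_and, Set.mem_ofPred_eq] at hi hj hij
  ext
  rw [← Nat.div_add_mod (i : ℕ) W, ← Nat.div_add_mod (j : ℕ) W, hij, hi.1, hj.1]

theorem toCircuit_evalAux (x : Fin n → Bool) (y : Fin 0 → Bool) (t : ℕ)
    (ht : t ≤ P.length) (r : ℕ) (hr : r < W) :
    (P.toCircuit W hW hP).evalAux x y (t * W + r) =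
      run x (P.take t) (fun _ => false) r := by
  have hN : t * W + r < (P.toCircuit W hW hP).N := by
    have : t * W ≤ P.length * W := Nat.mul_le_mul_right _ ht
    change _ < (P.length + 1) * W
    nlinarith
  rw [(P.toCircuit W hW hP).evalAux_eq_val x y ⟨_, hN⟩]
  change (P.gridNode W (t * W + r)).val x y _ = _
  cases t with
  | zero => simp [gridNode, hr, CNode.val, run]
  | succ t =>
    have hdiv : ((t + 1) * W + r) / W = t + 1 := by
      rw [Nat.mul_comm, Nat.mul_add_div hW, Nat.div_eq_of_lt hr]
    have hmod : ((t + 1) * W + r) % W = r := by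
      rw [Nat.mul_comm, Nat.mul_add_mod, Nat.mod_eq_of_lt hr]
    have hge : ¬ (t + 1) * W + r < W := by nlinarith
    have hsub : (t + 1) * W + r - W = t * W + r := by
      rw [Nat.succ_mul]
      omega
    have htl : t < P.length := ht
    have ih := toCircuit_evalAux x y t htl.le
    rw [List.take_succ_eq_append_getElem htl, run_append]
    simp only [gridNode, hge, if_false, hdiv, Nat.add_sub_cancel, hmod, hsub,
      List.getElem?_eq_getElem htl]
    by_cases h : r = P[t].1
    · rw [if_pos h, CNode.val_shift]
      simp only [run, List.foldl_cons, List.foldl_nil, step]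
      rw [h, Function.update_self, Subsingleton.elim y Fin.elim0]
      refine CNode.val_congr _ _ fun a ha => ?_
      rw [← Subsingleton.elim y Fin.elim0]
      exact ih a (hP _ (List.getElem_mem htl) a ha)
    · rw [if_neg h]
      simp only [run, List.foldl_cons, List.foldl_nil, step, CNode.val]
      rw [Function.update_of_ne h]
      exact ih r hr

theorem toCircuit_eval (x : Fin n → Bool) (y : Fin 0 → Bool) :
    (P.toCircuit W hW hP).eval x y = run x P (fun _ => false) 0 := by
  have h := toCircuit_evalAux hW hP x y P.length le_rfl 0 hW
  rwa [List.take_length] at h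

end RegProg

/-- Boolean formulas over the AND/OR/NOT basis. -/
inductive BoolFormula (n : ℕ) : Type where
  | var   : Fin n → BoolFormula n
  | const : Bool → BoolFormula n
  | neg   : BoolFormula n → BoolFormula n
  | conj  : BoolFormula n → BoolFormula n → BoolFormula n
  | disj  : BoolFormula n → BoolFormula n → BoolFormula n

namespace BoolFormula

variable {n : ℕ}

/-- The value of a formula on input `x`. -/
def eval (x : Fin n → Bool) : BoolFormula n → Bool
  | var v    => x v
  | const b  => b
  | neg F    => !F.eval x
  | conj F G => F.eval x && G.eval x
  | disj F G => F.eval x || G.eval x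

/-- The number of nodes of a formula. -/
def length : BoolFormula n → ℕ
  | var _    => 1
  | const _  => 1
  | neg F    => F.length + 1
  | conj F G => F.length + G.length + 1
  | disj F G => F.length + G.length + 1

/-- The number of registers used to evaluate a formula from left to right. -/
def regs : BoolFormula n → ℕ
  | var _    => 1
  | const _  => 1
  | neg F    => F.regs
  | conj F G => max F.regs (G.regs + 1)
  | disj F G => max F.regs (G.regs + 1)

theorem regs_pos (F : BoolFormula n) : 0 < F.regs := by
  induction F <;> simp_all [regs]

/-- A register program evaluating a formula into register `p`, leaving all
registers below `p` unchanged. -/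
def compile : BoolFormula n → ℕ → RegProg n
  | var v, p    => [(p, CNode.actual v)]
  | const b, p  => [(p, CNode.const b)]
  | neg F, p    => F.compile p ++ [(p, CNode.gnot p)]
  | conj F G, p => F.compile p ++ (G.compile (p + 1) ++ [(p, CNode.gand p (p + 1))])
  | disj F G, p => F.compile p ++ (G.compile (p + 1) ++ [(p, CNode.gor p (p + 1))])

theorem length_compile (F : BoolFormula n) (p : ℕ) : (F.compile p).length = F.length := by
  induction F generalizing p <;> simp_all [compile, length] <;> omega

theorem readsBelow_compile (F : BoolFormula n) (p : ℕ) :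
    (F.compile p).ReadsBelow (p + F.regs) := by
  induction F generalizing p with
  | var v => simp [RegProg.ReadsBelow, compile, CNode.preds]
  | const b => simp [RegProg.ReadsBelow, compile, CNode.preds]
  | neg F ihF =>
    intro ins hins a ha
    simp only [compile, List.mem_append, List.mem_singleton] at hins
    rcases hins with h | rfl
    · exact ihF p ins h a ha
    · have := F.regs_pos
      simp only [CNode.preds, List.mem_singleton] at ha
      simp only [regs]
      omega
  | conj F G ihF ihG | disj F G ihF ihG =>
    intro ins hins a ha
    have := G.regs_pos
    simp only [compile, List.mem_append, List.mem_singleton] at hins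
    simp only [regs]
    rcases hins with h | h | rfl
    · have := ihF p ins h a ha
      omega
    · have := ihG (p + 1) ins h a ha
      omega
    · simp only [CNode.preds, List.mem_cons, List.not_mem_nil, or_false] at ha
      omega

theorem run_compile (x : Fin n → Bool) (F : BoolFormula n) (p : ℕ) (σ : ℕ → Bool) :
    RegProg.run x (F.compile p) σ p = F.eval x ∧
      ∀ q < p, RegProg.run x (F.compile p) σ q = σ q := by
  induction F generalizing p σ with
  | var v | const b =>
    refine ⟨by simp [RegProg.run, compile, RegProg.step, CNode.val, eval], fun q hq => ?_⟩
    simp [RegProg.run, compile, RegProg.step, hq.ne]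
  | neg F ihF =>
    obtain ⟨h1, h2⟩ := ihF p σ
    simp only [compile, RegProg.run_append]
    refine ⟨?_, fun q hq => ?_⟩
    · simp [RegProg.run, RegProg.step, CNode.val, eval, ← h1]
    · rw [← h2 q hq]
      simp [RegProg.run, RegProg.step, hq.ne]
  | conj F G ihF ihG | disj F G ihF ihG =>
    obtain ⟨h1, h2⟩ := ihF p σ
    obtain ⟨h3, h4⟩ := ihG (p + 1) (RegProg.run x (F.compile p) σ)
    simp only [compile, RegProg.run_append]
    refine ⟨?_, fun q hq => ?_⟩
    · rw [eval, ← h3, ← h1, ← h4 p p.lt_succ_self]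
      simp [RegProg.run, RegProg.step, CNode.val]
    · rw [← h2 q hq, ← h4 q (by omega)]
      simp [RegProg.run, RegProg.step, hq.ne]

/-- A formula has a layered circuit whose width is its number of registers. -/
theorem exists_circuit (F : BoolFormula n) :
    ∃ D : Circuit n 0, (∀ x y, D.eval x y = F.eval x) ∧
      D.size ≤ (F.length + 1) * F.regs ∧ D.HasWidth F.regs := by
  have hP : (F.compile 0).ReadsBelow F.regs := by
    simpa using F.readsBelow_compile 0
  refine ⟨RegProg.toCircuit _ _ F.regs_pos hP, fun x y => ?_, ?_,
    RegProg.toCircuit_hasWidth _ _⟩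
  · rw [RegProg.toCircuit_eval]
    exact (run_compile x F 0 _).1
  · rw [← F.length_compile 0]
    exact RegProg.toCircuit_size_le _ _

/-- The disjunction of a list of formulas. -/
def bigDisj : List (BoolFormula n) → BoolFormula n
  | []     => const false
  | F :: L => disj (bigDisj L) F

theorem eval_bigDisj (x : Fin n → Bool) (L : List (BoolFormula n)) :
    (bigDisj L).eval x = true ↔ ∃ F ∈ L, F.eval x = true := by
  induction L with
  | nil => simp [bigDisj, eval]
  | cons F L ih => simp [bigDisj, eval, ih, or_comm]

theorem regs_bigDisj_le {L : List (BoolFormula n)} {w : ℕ} (h : ∀ F ∈ L, F.regs ≤ w) :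
    (bigDisj L).regs ≤ w + 1 := by
  induction L with
  | nil => simp [bigDisj, regs]
  | cons F L ih =>
    simp only [List.forall_mem_cons] at h
    have := ih h.2
    simp only [bigDisj, regs]
    omega

theorem length_bigDisj_le {L : List (BoolFormula n)} {a : ℕ} (h : ∀ F ∈ L, F.length ≤ a) :
    (bigDisj L).length ≤ 1 + L.length * (a + 1) := by
  induction L with
  | nil => simp [bigDisj, length]
  | cons F L ih =>
    simp only [List.forall_mem_cons] at h
    have := ih h.2
    simp only [bigDisj, length, List.length_cons]
    nlinarith [h.1]

end BoolFormula

namespace NBP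

open BoolFormula

variable {n : ℕ} (B : NBP n)

/-- The edge relation of the program on input `x`. -/
def Edge (x : Fin n → Bool) (i j : Fin B.N) : Prop :=
  ∃ v, B.label i = Sum.inl v ∧ j ∈ B.edges i (x v)

/-- There is a path of length `l` from `i` to `j` consistent with `x`. -/
def Steps (x : Fin n → Bool) : ℕ → Fin B.N → Fin B.N → Prop
  | 0, i, j     => i = j
  | l + 1, i, j => ∃ k, B.Edge x i k ∧ Steps x l k j

variable {B} {x : Fin n → Bool}

theorem steps_add {a b : ℕ} {i j : Fin B.N} :
    B.Steps x (a + b) i j ↔ ∃ k, B.Steps x a i k ∧ B.Steps x b k j := by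
  induction a generalizing i with
  | zero => simp [Steps]
  | succ a ih =>
    rw [Nat.succ_add]
    simp only [Steps, ih]
    constructor
    · rintro ⟨k, hk, m, h1, h2⟩
      exact ⟨m, ⟨k, hk, h1⟩, h2⟩
    · rintro ⟨m, ⟨k, hk, h1⟩, h2⟩
      exact ⟨k, hk, m, h1, h2⟩

theorem Steps.add_le {l : ℕ} {i j : Fin B.N} (h : B.Steps x l i j) :
    (i : ℕ) + l ≤ j := by
  induction l generalizing i with
  | zero => exact (congrArg Fin.val h).le
  | succ l ih =>
    obtain ⟨k, ⟨v, _, hk⟩, h⟩ := h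
    have := (B.wf i _ k hk).1
    have := ih h
    omega

theorem accFrom_iff (i : Fin B.N) :
    B.AccFrom x i ↔ ∃ l j, B.Steps x l i j ∧ B.label j = Sum.inr true := by
  rw [AccFrom]
  split
  · rename_i b hb
    constructor
    · rintro rfl
      exact ⟨0, i, rfl, hb⟩
    · rintro ⟨l, j, h, hj⟩
      cases l with
      | zero =>
        obtain rfl : i = j := h
        simpa [hb] using hj
      | succ l =>
        obtain ⟨k, ⟨v, hv, _⟩, _⟩ := h
        simp [hb] at hv
  · rename_i v hv
    constructor
    · rintro ⟨k, hk, hlt, hacc⟩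
      obtain ⟨l, j, h, hj⟩ := (accFrom_iff k).1 hacc
      exact ⟨l + 1, j, ⟨k, ⟨v, hv, hk⟩, h⟩, hj⟩
    · rintro ⟨l, j, h, hj⟩
      cases l with
      | zero =>
        obtain rfl : i = j := h
        simp [hv] at hj
      | succ l =>
        obtain ⟨k, ⟨w, hw, hk⟩, h⟩ := h
        obtain rfl : v = w := by simpa [hv] using hw
        have hlt := (B.wf i _ k hk).1
        exact ⟨k, hk, hlt, (accFrom_iff k).2 ⟨l, j, h, hj⟩⟩
termination_by B.N - (i : ℕ)

variable (B)

/-- A formula deciding whether `j` is reached from `i` in at most one step. -/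
def edgeFormula (i j : Fin B.N) : BoolFormula n :=
  if i = j then const true
  else match B.label i with
    | Sum.inr _ => const false
    | Sum.inl v =>
      if j ∈ B.edges i true then
        if j ∈ B.edges i false then const true else var v
      else
        if j ∈ B.edges i false then neg (var v) else const false

/-- A formula deciding, by recursive halving, whether `j` is reached from `i` in at
most `2 ^ k` steps. -/
def reachFormula : ℕ → Fin B.N → Fin B.N → BoolFormula n
  | 0, i, j     => B.edgeFormula i j
  | k + 1, i, j => bigDisj <| (List.finRange B.N).map fun m =>
      conj (reachFormula k i m) (reachFormula k m j)

/-- A formula deciding whether a 1-sink is reached from the start node in at most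
`2 ^ k` steps. -/
def accFormula (k : ℕ) : BoolFormula n :=
  bigDisj <| ((List.finRange B.N).filter fun j => B.label j = Sum.inr true).map
    fun j => B.reachFormula k B.start j

variable {B}

theorem eval_edgeFormula {i j : Fin B.N} :
    (B.edgeFormula i j).eval x = true ↔ i = j ∨ B.Edge x i j := by
  unfold edgeFormula Edge
  by_cases hij : i = j
  · simp [hij, BoolFormula.eval]
  · simp only [hij, if_false, false_or]
    split
    · rename_i hb
      simp [hb, BoolFormula.eval]
    · rename_i v hv
      cases hx : x v <;> split_ifs <;> simp_all [BoolFormula.eval]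

theorem eval_reachFormula {k : ℕ} {i j : Fin B.N} :
    (B.reachFormula k i j).eval x = true ↔ ∃ l ≤ 2 ^ k, B.Steps x l i j := by
  induction k generalizing i j with
  | zero =>
    rw [reachFormula, eval_edgeFormula]
    constructor
    · rintro (h | h)
      · exact ⟨0, by simp, h⟩
      · exact ⟨1, by simp, j, h, rfl⟩
    · rintro ⟨l, hl, h⟩
      obtain rfl | rfl : l = 0 ∨ l = 1 := by
        rw [pow_zero] at hl
        omega
      · exact Or.inl h
      · obtain ⟨k, hk, rfl : k = j⟩ := h
        exact Or.inr hk
  | succ k ih =>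
    simp only [reachFormula, eval_bigDisj, List.mem_map, List.mem_finRange, true_and,
      exists_exists_eq_and, BoolFormula.eval, Bool.and_eq_true, ih]
    rw [pow_succ]
    constructor
    · rintro ⟨m, ⟨a, ha, h1⟩, b, hb, h2⟩
      exact ⟨a + b, by omega, steps_add.2 ⟨m, h1, h2⟩⟩
    · rintro ⟨l, hl, h⟩
      rw [← Nat.add_sub_of_le (min_le_left l (2 ^ k)), steps_add] at h
      obtain ⟨m, h1, h2⟩ := h
      exact ⟨m, ⟨_, min_le_right _ _, h1⟩, _, by omega, h2⟩

theorem eval_accFormula {k : ℕ} (hk : B.N ≤ 2 ^ k) :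
    (B.accFormula k).eval x = true ↔ B.AccFrom x B.start := by
  simp only [accFormula, eval_bigDisj, List.mem_map, List.mem_filter, List.mem_finRange,
    true_and, decide_eq_true_eq, accFrom_iff, exists_exists_and_eq_and, eval_reachFormula]
  constructor
  · rintro ⟨j, hj, l, _, h⟩
    exact ⟨l, j, h, hj⟩
  · rintro ⟨l, j, h, hj⟩
    have := h.add_le
    exact ⟨j, hj, l, by omega, h⟩

theorem regs_reachFormula_le (k : ℕ) (i j : Fin B.N) :
    (B.reachFormula k i j).regs ≤ 2 * k + 1 := by
  induction k generalizing i j with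
  | zero =>
    simp only [reachFormula, edgeFormula]
    split_ifs <;> (try split) <;> simp [regs]
  | succ k ih =>
    rw [reachFormula]
    refine regs_bigDisj_le (w := 2 * k + 2) fun F hF => ?_
    obtain ⟨m, _, rfl⟩ := List.mem_map.1 hF
    have := ih i m
    have := ih m j
    simp only [regs]
    omega

theorem regs_accFormula_le (k : ℕ) : (B.accFormula k).regs ≤ 2 * k + 2 := by
  refine regs_bigDisj_le fun F hF => ?_
  obtain ⟨j, _, rfl⟩ := List.mem_map.1 hF
  exact regs_reachFormula_le k _ j

theorem length_reachFormula_le (k : ℕ) (i j : Fin B.N) :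
    (B.reachFormula k i j).length + 2 ≤ (4 * B.N) ^ (k + 1) := by
  have hN : 1 ≤ B.N := i.pos
  induction k generalizing i j with
  | zero =>
    have : (B.reachFormula 0 i j).length ≤ 2 := by
      simp only [reachFormula, edgeFormula]
      split_ifs <;> (try split) <;> simp [length]
    rw [zero_add, pow_one]
    omega
  | succ k ih =>
    set A := (4 * B.N) ^ (k + 1) with hA
    have hA2 : 2 ≤ A := le_trans (by omega) (ih i j)
    have h : (B.reachFormula (k + 1) i j).length ≤ 1 + B.N * (2 * (A - 2) + 1 + 1) := by
      rw [reachFormula]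
      refine (length_bigDisj_le (a := 2 * (A - 2) + 1) fun F hF => ?_).trans_eq (by simp)
      obtain ⟨m, _, rfl⟩ := List.mem_map.1 hF
      have := ih i m
      have := ih m j
      simp only [length]
      omega
    obtain ⟨a, ha⟩ := Nat.exists_eq_add_of_le' hA2
    rw [pow_succ, ← hA]
    rw [ha] at h ⊢
    rw [Nat.add_sub_cancel] at h
    nlinarith

theorem length_accFormula_le (k : ℕ) :
    (B.accFormula k).length ≤ 1 + B.N * ((4 * B.N) ^ (k + 1) - 1) := by
  have hA : 2 ≤ (4 * B.N) ^ (k + 1) :=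
    le_trans (by omega) (length_reachFormula_le k B.start B.start)
  refine (length_bigDisj_le (a := (4 * B.N) ^ (k + 1) - 2) fun F hF => ?_).trans ?_
  · obtain ⟨j, _, rfl⟩ := List.mem_map.1 hF
    have := length_reachFormula_le k B.start j
    omega
  · have hlen : ((List.finRange B.N).filter fun j => B.label j = Sum.inr true).length ≤ B.N :=
      (List.length_filter_le _ _).trans_eq (List.length_finRange)
    rw [List.length_map, show (4 * B.N) ^ (k + 1) - 2 + 1 = (4 * B.N) ^ (k + 1) - 1 by omega]
    gcongr

theorem length_mul_regs_accFormula_le {k : ℕ} (hN : 2 ≤ B.N) (hk : B.N ≤ 2 ^ k) :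
    ((B.accFormula k).length + 1) * (B.accFormula k).regs ≤ 2 ^ (k ^ 2 + 5 * k + 3) := by
  have hA : 1 ≤ (4 * B.N) ^ (k + 1) := Nat.one_le_pow _ _ (by omega)
  have h1 : (B.accFormula k).length + 1 ≤ B.N * (4 * B.N) ^ (k + 1) := by
    have := length_accFormula_le (B := B) k
    obtain ⟨a, ha⟩ := Nat.exists_eq_add_of_le' hA
    rw [ha, Nat.add_sub_cancel] at this
    rw [ha]
    nlinarith
  have h2 : B.N * (4 * B.N) ^ (k + 1) ≤ 2 ^ k * (2 ^ (k + 2)) ^ (k + 1) := by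
    have : 4 * B.N ≤ 2 ^ (k + 2) := by
      rw [pow_add]
      omega
    gcongr
  have h3 : (B.accFormula k).regs ≤ 2 ^ (k + 1) := by
    have := regs_accFormula_le (B := B) k
    have : k < 2 ^ k := Nat.lt_two_pow_self
    rw [pow_succ]
    omega
  calc _ ≤ 2 ^ k * (2 ^ (k + 2)) ^ (k + 1) * 2 ^ (k + 1) :=
        Nat.mul_le_mul (h1.trans h2) h3
    _ = 2 ^ (k ^ 2 + 5 * k + 3) := by
        rw [← pow_mul, ← pow_add, ← pow_add]
        congr 1
        ring

theorem accFrom_iff_of_subsingleton (hN : B.N = 1) :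
    B.AccFrom x B.start ↔ B.label B.start = Sum.inr true := by
  have : Subsingleton (Fin B.N) := by
    rw [hN]
    infer_instance
  rw [accFrom_iff]
  constructor
  · rintro ⟨_, j, _, hj⟩
    rwa [Subsingleton.elim B.start j]
  · exact fun h => ⟨0, _, rfl, h⟩

end NBP

/-- The circuit consisting of a single constant. -/
def Circuit.ofConst (n : ℕ) (b : Bool) : Circuit n 0 where
  N := 1
  node _ := CNode.const b
  output := 0
  wf := by simp [CNode.preds]
  guessOnce g := g.elim0

/-- There is an absolute constant `c > 0` such that every
nondeterministic branching program of size `s` computing a Boolean function `f`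
can be converted to a deterministic Boolean circuit computing `f` of size at
most `2^(c·(log₂ s)²)` and width at most `c·log₂ s`. -/
theorem nbp_to_bounded_width_circuit :
    ∃ c : ℝ, 0 < c ∧
      ∀ (n : ℕ) (B : NBP n) (f : (Fin n → Bool) → Bool),
        B.Computes f →
        ∃ D : Circuit n 0, D.Computes f ∧
          (D.size : ℝ) ≤ 2 ^ (c * (Real.logb 2 (B.size : ℝ)) ^ 2) ∧
          ∃ w : ℕ, D.HasWidth w ∧ (w : ℝ) ≤ c * Real.logb 2 (B.size : ℝ) := by
  refine ⟨17, by norm_num, fun n B f hf => ?_⟩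
  have hpos : 1 ≤ B.N := B.start.pos
  obtain hN | hN : B.N = 1 ∨ 2 ≤ B.N := by omega
  · refine ⟨Circuit.ofConst n (decide (B.label B.start = Sum.inr true)), fun x => ?_, ?_, 0, ?_, ?_⟩
    · have heval (y : Fin 0 → Bool) :
          (Circuit.ofConst n (decide (B.label B.start = Sum.inr true))).eval x y =
            decide (B.label B.start = Sum.inr true) :=
        Circuit.evalAux_eq_val _ x y _
      simp [hf x, NBP.accFrom_iff_of_subsingleton hN, heval]
    · rw [Circuit.size, Finset.card_eq_zero.2 (Finset.filter_eq_empty_iff.2 fun i _ => by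
        simp [Circuit.ofConst, CNode.isGate])]
      simp [NBP.size, hN]
    · exact ⟨fun _ => 0, by simp [Circuit.IsLayering, Circuit.ofConst, CNode.preds],
        fun t => (Finset.card_eq_zero.2 (Finset.filter_eq_empty_iff.2 fun i _ => by
          simp [Circuit.ofConst, CNode.isWide])).le⟩
    · simp [NBP.size, hN]
  · set M := Real.logb 2 (B.size : ℝ) with hM
    set k := Nat.clog 2 B.N with hk
    have hNk : B.N ≤ 2 ^ k := Nat.le_pow_clog (by norm_num) _
    have hNR : (2 : ℝ) ≤ (B.N : ℝ) := by exact_mod_cast hN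
    have hM1 : 1 ≤ M := by
      rw [hM, Real.le_logb_iff_rpow_le (by norm_num) (by simp only [NBP.size]; linarith)]
      simpa [NBP.size] using hNR
    have hkM : (k : ℝ) ≤ 2 * M := by
      have hlt : 2 ^ (k - 1) < B.N := Nat.pow_pred_clog_lt_self (by norm_num) hN
      have hle : ((k - 1 : ℕ) : ℝ) ≤ M := by
        rw [hM, Real.le_logb_iff_rpow_le (by norm_num) (by simp only [NBP.size]; linarith),
          Real.rpow_natCast]
        exact_mod_cast hlt.le
      have : (k : ℝ) ≤ ((k - 1 : ℕ) : ℝ) + 1 := by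
        exact_mod_cast (by omega : k ≤ k - 1 + 1)
      linarith
    obtain ⟨D, hD, hsize, hwidth⟩ := (B.accFormula k).exists_circuit
    refine ⟨D, fun x => ?_, ?_, _, hwidth, ?_⟩
    · simp [hf x, hD, NBP.eval_accFormula hNk]
    · have h : (D.size : ℝ) ≤ 2 ^ (k ^ 2 + 5 * k + 3) := by
        exact_mod_cast hsize.trans (NBP.length_mul_regs_accFormula_le hN hNk)
      refine h.trans ?_
      rw [← Real.rpow_natCast]
      refine Real.rpow_le_rpow_of_exponent_le (by norm_num) ?_
      push_cast
      have hk0 : (0 : ℝ) ≤ k := Nat.cast_nonneg k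
      nlinarith
    · have h : ((B.accFormula k).regs : ℝ) ≤ 2 * k + 2 := by
        exact_mod_cast NBP.regs_accFormula_le k
      linarith
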